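/- If λ →deg μ is a non-trivial degeneration of Lie algebra laws on ℂⁿ (that is, μ lies in the closure of the orbit O(λ) but μ ∉ O(λ)), then the dimension of the derivation algebra strictly increases: dim Der(λ) < dim Der(μ), where Der(λ) is the Lie algebra of linear maps D : ℂⁿ → ℂⁿ with D(λ(x,y)) = λ(Dx,y) + λ(x,Dy) for all x,y. -/

import Mathlib

open Module Submodule Filter Topology

/-- The underlying vector space `ℂⁿ`. -/
abbrev V (n : ℕ) : Type := Fin n → ℂ

/-- A Lie algebra law on `ℂⁿ`: an alternating bilinear map satisfying the Jacobi identity. -/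
def IsLieLaw {n : ℕ} (μ : V n → V n → V n) : Prop :=
  (∀ (a : ℂ) (x y z : V n), μ (a • x + y) z = a • μ x z + μ y z) ∧
  (∀ (a : ℂ) (x y z : V n), μ x (a • y + z) = a • μ x y + μ x z) ∧
  (∀ x : V n, μ x x = 0) ∧
  (∀ x y z : V n, μ x (μ y z) + μ y (μ z x) + μ z (μ x y) = 0)

/-- The base-change action of `GL_n(ℂ)` on laws: `(g·μ)(x,y) = g (μ (g⁻¹ x) (g⁻¹ y))`. -/
noncomputable def act {n : ℕ} (g : V n ≃ₗ[ℂ] V n) (μ : V n → V n → V n) : V n → V n → V n :=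
  fun x y => g (μ (g.symm x) (g.symm y))

/-- The `GL_n(ℂ)`-orbit of a law. -/
def lieOrbit {n : ℕ} (μ : V n → V n → V n) : Set (V n → V n → V n) :=
  {ν | ∃ g : V n ≃ₗ[ℂ] V n, ν = act g μ}

/-- `μ` is a degeneration of `λ` if `μ` lies in the closure of the orbit of `λ`. -/
def Degenerates {n : ℕ} (lam mu : V n → V n → V n) : Prop :=
  mu ∈ closure (lieOrbit lam)

/-- The derivation algebra `Der(μ)` of all linear maps `D` with
`D(μ(x,y)) = μ(Dx,y) + μ(x,Dy)`. -/
noncomputable def derAlgebra {n : ℕ} (μ : V n → V n → V n) : Submodule ℂ (Module.End ℂ (V n)) :=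
  Submodule.span ℂ {D : Module.End ℂ (V n) | ∀ x y : V n, D (μ x y) = μ (D x) y + μ x (D y)}

section AlgPart
open Polynomial


theorem exists_dual_point_aux {A : Type} [CommRing A] [IsDomain A] [Algebra ℂ A]
    [Algebra ℂ[X] A] [IsScalarTower ℂ ℂ[X] A]
    [Algebra.FiniteType ℂ A] (hinj : Function.Injective (algebraMap ℂ[X] A)) :
    ∃ φ : A →ₐ[ℂ] DualNumber ℂ, (φ (algebraMap ℂ[X] A X)).snd = 1 := by
  have : FaithfulSMul ℂ[X] A := (faithfulSMul_iff_algebraMap_injective _ _).mpr hinj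
  have : Algebra.FiniteType ℂ[X] A := .of_restrictScalars_finiteType ℂ _ _
  have : Algebra.FinitePresentation ℂ[X] A := Algebra.FinitePresentation.of_finiteType.mp this
  let L := Localization.AtPrime (⊥ : Ideal A)
  let k := FractionRing ℂ[X]
  have hfr : IsFractionRing A L := by
    have : (⊥ : Ideal A).primeCompl = nonZeroDivisors A := by
      ext x; simp [Ideal.primeCompl, mem_nonZeroDivisors_iff_ne_zero]
    show IsLocalization (nonZeroDivisors A) L
    rw [← this]; infer_instance
  let _ : Field L := IsFractionRing.toField A
  have : FaithfulSMul ℂ[X] L := (faithfulSMul_iff_algebraMap_injective _ _).mpr (by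
    rw [IsScalarTower.algebraMap_eq ℂ[X] A L]
    exact (IsFractionRing.injective A L).comp hinj)
  let _ : Algebra k L := FractionRing.liftAlgebra ℂ[X] L
  have : IsScalarTower ℂ[X] k L := FractionRing.isScalarTower_liftAlgebra ℂ[X] L
  have : CharZero k := charZero_of_injective_algebraMap (FaithfulSMul.algebraMap_injective ℂ k)
  have : Algebra.EssFiniteType A L := Algebra.EssFiniteType.of_isLocalization _ (nonZeroDivisors A)
  have : Algebra.EssFiniteType ℂ[X] L := Algebra.EssFiniteType.comp _ A _
  have : Algebra.EssFiniteType k L := Algebra.EssFiniteType.of_comp ℂ[X] k L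
  have : Algebra.FormallySmooth k L := inferInstance
  have : Algebra.FormallySmooth ℂ[X] k := .of_isLocalization (nonZeroDivisors _)
  have : Algebra.FormallySmooth ℂ[X] L := .comp _ k _
  have : Algebra.IsSmoothAt ℂ[X] (⊥ : Ideal A) := this
  obtain ⟨s, hs, hsm⟩ := Algebra.IsSmoothAt.exists_notMem_smooth (R := ℂ[X]) (⊥ : Ideal A)
  let As := Localization.Away s
  have : Nontrivial As := by
    have hle : Submonoid.powers s ≤ nonZeroDivisors A :=
      powers_le_nonZeroDivisors_of_noZeroDivisors (by simpa using hs)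
    exact (IsLocalization.injective As hle).nontrivial
  obtain ⟨M, hM⟩ := Ideal.exists_maximal As
  let _ : Field (As ⧸ M) := Ideal.Quotient.field M
  have : Algebra.FiniteType A As := by
    have : Algebra.FinitePresentation A As := IsLocalization.Away.finitePresentation s
    infer_instance
  have : Algebra.FiniteType ℂ As := Algebra.FiniteType.trans ‹_› this
  have : Algebra.FiniteType ℂ (As ⧸ M) := inferInstance
  have : Module.Finite ℂ (As ⧸ M) := finite_of_finite_type_of_isJacobsonRing ℂ (As ⧸ M)
  have hbij : Function.Bijective (algebraMap ℂ (As ⧸ M)) := 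
    IsAlgClosed.algebraMap_bijective_of_isIntegral
  let e : ℂ ≃ₐ[ℂ] As ⧸ M := AlgEquiv.ofBijective (Algebra.ofId _ _) hbij
  let ψ : As →ₐ[ℂ] ℂ := e.symm.toAlgHom.comp (Ideal.Quotient.mkₐ ℂ M)
  let x : ℂ := ψ (algebraMap ℂ[X] As X)
  let θ : ℂ[X] →ₐ[ℂ] DualNumber ℂ := aeval (TrivSqZeroExt.inl x + DualNumber.eps)
  let π : DualNumber ℂ →ₐ[ℂ] ℂ := TrivSqZeroExt.fstHom ℂ ℂ ℂ
  have hψ : ∀ p : ℂ[X], ψ (algebraMap ℂ[X] As p) = π (θ p) := by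
    intro p
    have : ψ.comp (IsScalarTower.toAlgHom ℂ ℂ[X] As) = π.comp θ := by
      ext; simp [θ, π, x]
    exact congr($this p)
  have hθ1 : ∀ r : ℂ, θ (C r) = algebraMap ℂ _ r := fun r => by simp [θ]
  have hθ2 : (θ X).snd = 1 := by simp [θ]
  have hker : RingHom.ker (π : DualNumber ℂ →+* ℂ) ^ 2 = ⊥ := by
    rw [pow_two, eq_bot_iff, Ideal.mul_le]
    intro a ha b hb
    have ha' : a.fst = 0 := ha
    have hb' : b.fst = 0 := hb
    show a * b = 0
    ext <;> simp [ha', hb']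
  let _ : Algebra ℂ[X] (DualNumber ℂ) := θ.toRingHom.toAlgebra
  let _ : Algebra ℂ[X] ℂ := (π.comp θ).toRingHom.toAlgebra
  let ψ' : As →ₐ[ℂ[X]] ℂ := { ψ.toRingHom with commutes' := hψ }
  let π' : DualNumber ℂ →ₐ[ℂ[X]] ℂ := { π.toRingHom with commutes' := fun p => rfl }
  have hsurj : Function.Surjective π' := fun z => ⟨TrivSqZeroExt.inl z, rfl⟩
  have hnil : IsNilpotent (RingHom.ker (π' : DualNumber ℂ →+* ℂ)) := by
    exact ⟨2, hker⟩
  have : Algebra.FormallySmooth ℂ[X] As := inferInstance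
  let Φ : As →ₐ[ℂ[X]] DualNumber ℂ := Algebra.FormallySmooth.liftOfSurjective ψ' π' hsurj hnil
  have hΦ : ∀ p : ℂ[X], Φ (algebraMap ℂ[X] As p) = θ p := fun p => Φ.commutes p
  refine ⟨{ Φ.toRingHom.comp (algebraMap A As) with commutes' := fun r => ?_ }, ?_⟩
  · show Φ (algebraMap A As (algebraMap ℂ A r)) = _
    rw [IsScalarTower.algebraMap_apply ℂ ℂ[X] A, ← IsScalarTower.algebraMap_apply ℂ[X] A As, hΦ]
    exact hθ1 r
  · show (Φ (algebraMap A As (algebraMap ℂ[X] A X))).snd = 1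
    rw [← IsScalarTower.algebraMap_apply ℂ[X] A As, hΦ]
    exact hθ2

theorem isAlgebraic_const {A : Type} [CommRing A] [IsDomain A] [Algebra ℂ A] {f : A}
    (hf : IsAlgebraic ℂ f) : ∃ c : ℂ, f = algebraMap ℂ A c := by
  have hint : IsIntegral ℂ f := hf.isIntegral
  have hirr := minpoly.irreducible hint
  have hdeg := IsAlgClosed.degree_eq_one_of_irreducible ℂ hirr
  obtain ⟨c, hc⟩ := minpoly.mem_range_of_degree_eq_one ℂ f hdeg
  exact ⟨c, hc.symm⟩

theorem isAlgebraic_of_dual {A : Type} [CommRing A] [IsDomain A] [Algebra ℂ A]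
    [Algebra.FiniteType ℂ A] (f : A) (h : ∀ φ : A →ₐ[ℂ] DualNumber ℂ, (φ f).snd = 0) :
    ∃ c : ℂ, f = algebraMap ℂ A c := by
  by_cases hf : IsAlgebraic ℂ f
  · obtain ⟨c, hc⟩ := isAlgebraic_const hf
    exact ⟨c, hc⟩
  · exfalso
    let _ : Algebra ℂ[X] A := (aeval f).toRingHom.toAlgebra
    have : IsScalarTower ℂ ℂ[X] A := .of_algebraMap_eq fun r => by
      show _ = aeval f _
      simp
    obtain ⟨φ, hφ⟩ := exists_dual_point_aux (A := A) (transcendental_iff_injective.mp hf)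
    have : algebraMap ℂ[X] A X = f := by
      show aeval f X = f
      simp
    rw [this, h φ] at hφ
    exact zero_ne_one hφ

theorem finite_values {B : Type} [CommRing B] [Algebra ℂ B] [Algebra.FiniteType ℂ B] (f : B)
    (h : ∀ φ : B →ₐ[ℂ] DualNumber ℂ, (φ f).snd = 0) :
    {z : ℂ | ∃ ψ : B →ₐ[ℂ] ℂ, ψ f = z}.Finite := by
  have : IsNoetherianRing B := Algebra.FiniteType.isNoetherianRing ℂ B
  have hfin := minimalPrimes.finite_of_isNoetherianRing B
  have key : ∀ P ∈ minimalPrimes B, ∃ c : ℂ, f - algebraMap ℂ B c ∈ P := by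
    intro P hP
    have : P.IsPrime := hP.1.1
    obtain ⟨c, hc⟩ := isAlgebraic_of_dual (A := B ⧸ P) (Ideal.Quotient.mk P f)
      (fun φ => h (φ.comp (Ideal.Quotient.mkₐ ℂ P)))
    refine ⟨c, ?_⟩
    rw [← Ideal.Quotient.eq, hc]; rfl
  choose! c hc using key
  refine (hfin.image c).subset ?_
  rintro z ⟨ψ, rfl⟩
  have hp : (RingHom.ker ψ).IsPrime := RingHom.ker_isPrime _
  obtain ⟨P, hP, hle⟩ := Ideal.exists_minimalPrimes_le (I := ⊥) (J := RingHom.ker ψ) bot_le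
  refine ⟨P, hP, ?_⟩
  have := hle (hc P hP)
  rw [RingHom.mem_ker, map_sub, sub_eq_zero] at this
  simpa using this.symm

theorem finite_values_poly {σ : Type} [Finite σ] (E : Set (MvPolynomial σ ℂ)) (f : MvPolynomial σ ℂ)
    (h : ∀ z : σ → DualNumber ℂ, (∀ p ∈ E, MvPolynomial.aeval z p = 0) →
      (MvPolynomial.aeval z f).snd = 0) :
    {w : ℂ | ∃ z : σ → ℂ, (∀ p ∈ E, MvPolynomial.aeval z p = 0) ∧
      MvPolynomial.aeval z f = w}.Finite := by
  let B := MvPolynomial σ ℂ ⧸ Ideal.span E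
  refine (finite_values (B := B) (Ideal.Quotient.mk _ f) ?_).subset ?_
  · intro φ
    let χ := φ.comp (Ideal.Quotient.mkₐ ℂ (Ideal.span E))
    have hχ : χ = MvPolynomial.aeval (fun i => χ (MvPolynomial.X i)) := by
      ext <;> simp
    have := h (fun i => χ (MvPolynomial.X i)) (fun p hp => by
      rw [← hχ]
      show φ (Ideal.Quotient.mk _ p) = 0
      rw [Ideal.Quotient.eq_zero_iff_mem.mpr (Ideal.subset_span hp), map_zero])
    rw [← hχ] at this
    exact this
  · rintro w ⟨z, hz, rfl⟩
    refine ⟨Ideal.Quotient.liftₐ _ (MvPolynomial.aeval z) ?_, ?_⟩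
    · intro a ha
      have : Ideal.span E ≤ RingHom.ker (MvPolynomial.aeval (R := ℂ) z) :=
        Ideal.span_le.mpr fun p hp => hz p hp
      exact this ha
    · rfl
end AlgPart
/-- structure constants of bilinear laws -/
abbrev LW (n : ℕ) : Type := Fin n → Fin n → Fin n → ℂ

abbrev LM (n : ℕ) : Type := Matrix (Fin n) (Fin n) ℂ

noncomputable def br {n : ℕ} (c : LW n) : V n →ₗ[ℂ] V n →ₗ[ℂ] V n :=
  LinearMap.mk₂ ℂ (fun x y k => ∑ i, ∑ j, x i * y j * c i j k)
    (by intros; ext; simp [add_mul, Finset.sum_add_distrib])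
    (by intros; ext; simp [Finset.mul_sum, mul_assoc])
    (by intros; ext; simp [add_mul, mul_add, Finset.sum_add_distrib])
    (by intros; ext; simp [Finset.mul_sum, mul_left_comm, mul_assoc])

theorem br_apply {n : ℕ} (c : LW n) (x y : V n) (k : Fin n) :
    br c x y k = ∑ i, ∑ j, x i * y j * c i j k := rfl

theorem br_single {n : ℕ} (c : LW n) (i j : Fin n) :
    br c (Pi.single i 1) (Pi.single j 1) = c i j := by
  ext k
  simp [br_apply, Pi.single_apply]

theorem br_inj {n : ℕ} {c d : LW n} (h : ∀ x y, br c x y = br d x y) : c = d := by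
  ext i j k
  rw [← br_single c, ← br_single d, h]

theorem bil_ext {n : ℕ} {f g : V n →ₗ[ℂ] V n →ₗ[ℂ] V n}
    (h : ∀ i j, f (Pi.single i 1) (Pi.single j 1) = g (Pi.single i 1) (Pi.single j 1)) : f = g := by
  refine (Pi.basisFun ℂ (Fin n)).ext fun i => (Pi.basisFun ℂ (Fin n)).ext fun j => ?_
  simpa using h i j

noncomputable def del {n : ℕ} (c : LW n) : LM n →ₗ[ℂ] LW n where
  toFun Y := fun i j k => ∑ l, Y k l * c i j l - ∑ a, Y a i * c a j k - ∑ a, Y a j * c i a k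
  map_add' := by
    intros; ext; simp [add_mul, Finset.sum_add_distrib]; ring
  map_smul' := by
    intros; ext; simp [Finset.mul_sum, mul_assoc, mul_sub]

theorem del_apply {n : ℕ} (c : LW n) (Y : LM n) (i j k : Fin n) : del c Y i j k =
    ∑ l, Y k l * c i j l - ∑ a, Y a i * c a j k - ∑ a, Y a j * c i a k := rfl

theorem br_del {n : ℕ} (c : LW n) (Y : LM n) (x y : V n) :
    br (del c Y) x y = Y.mulVec (br c x y) - br c (Y.mulVec x) y - br c x (Y.mulVec y) := by
  have : br (del c Y) = (br c).compr₂ Y.toLin' - (br c).comp Y.toLin' - (br c).compl₂ Y.toLin' := by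
    apply bil_ext
    intro i j
    rw [br_single]
    ext k
    simp [br_single, del_apply, br_apply, Matrix.mulVec, dotProduct, Pi.single_apply]
  rw [this]
  simp

theorem del_eq_zero_iff {n : ℕ} (c : LW n) (Y : LM n) : del c Y = 0 ↔
    ∀ x y, Y.mulVec (br c x y) = br c (Y.mulVec x) y + br c x (Y.mulVec y) := by
  constructor
  · intro h x y
    have := br_del c Y x y
    rw [h, sub_sub, eq_comm] at this
    rw [← sub_eq_zero, this]
    ext; simp [br_apply]
  · intro h
    apply br_inj
    intro x y
    rw [br_del, h]
    ext; simp [br_apply]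

/-- `g` intertwines `c` and `d`. -/
def LRel {n : ℕ} (c : LW n) (g : LM n) (d : LW n) : Prop :=
  ∀ i j k, ∑ l, g k l * c i j l = ∑ a, ∑ b, g a i * g b j * d a b k

theorem rel_iff {n : ℕ} (c : LW n) (g : LM n) (d : LW n) : LRel c g d ↔
    ∀ x y, g.mulVec (br c x y) = br d (g.mulVec x) (g.mulVec y) := by
  have h1 : ∀ i j k, g.mulVec (br c (Pi.single i 1) (Pi.single j 1)) k = ∑ l, g k l * c i j l := by
    intro i j k
    rw [br_single]; rfl
  have h2 : ∀ i j k, br d (g.mulVec (Pi.single i 1)) (g.mulVec (Pi.single j 1)) k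
      = ∑ a, ∑ b, g a i * g b j * d a b k := by
    intro i j k
    simp [br_apply]
  constructor
  · intro h
    have : (br c).compr₂ g.toLin' = (br d).compl₁₂ g.toLin' g.toLin' := by
      apply bil_ext
      intro i j
      ext k
      have := h i j k
      rw [← h1, ← h2] at this
      simpa using this
    intro x y
    simpa using congr($this x y)
  · intro h i j k
    rw [← h1, ← h2, h]

theorem LRel.trans {n : ℕ} {c d e : LW n} {g h : LM n} (h1 : LRel c g d) (h2 : LRel d h e) :
    LRel c (h * g) e := by
  rw [rel_iff] at *
  intro x y
  rw [← Matrix.mulVec_mulVec, h1, h2]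
  simp

theorem finrank_ker_le {n : ℕ} {c d : LW n} {g h : LM n} (hgh : g * h = 1) (hr : LRel c g d) :
    finrank ℂ (LinearMap.ker (del c)) ≤ finrank ℂ (LinearMap.ker (del d)) := by
  have hhg : h * g = 1 := mul_eq_one_comm.mp hgh
  rw [rel_iff] at hr
  let e : LM n →ₗ[ℂ] LM n := (LinearMap.mulLeft ℂ g).comp (LinearMap.mulRight ℂ h)
  have he : Function.Injective e := by
    intro Z Z' hZ
    have hZ' : g * (Z * h) = g * (Z' * h) := hZ
    have := congr(h * $hZ' * g)
    simpa [mul_assoc, hhg, ← mul_assoc h g] using this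
  have hmap : ∀ Z ∈ LinearMap.ker (del c), e Z ∈ LinearMap.ker (del d) := by
    intro Z hZ
    have hZ' : del _ _ = 0 := hZ
    show del d (g * (Z * h)) = 0
    rw [del_eq_zero_iff] at *
    intro x y
    have e1 := hr (h.mulVec x) (h.mulVec y)
    have e2 := hr (Z.mulVec (h.mulVec x)) (h.mulVec y)
    have e3 := hr (h.mulVec x) (Z.mulVec (h.mulVec y))
    have e4 := hZ' (h.mulVec x) (h.mulVec y)
    simp only [Matrix.mulVec_mulVec, hgh, Matrix.one_mulVec, mul_assoc] at e1 e2 e3 e4 ⊢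
    rw [← e2, ← e3, ← Matrix.mulVec_add, ← e4, ← e1]
    simp only [Matrix.mulVec_mulVec, mul_assoc, hhg, mul_one]
  exact LinearMap.finrank_le_finrank_of_injective (f := e.restrict hmap)
    (fun a b hab => Subtype.ext (he congr(($hab : LM n))))

theorem tangent_eq {n : ℕ} {c d : LW n} {g h : LM n} (hgh : g * h = 1) (hr : LRel c g d)
    (X : LM n) (η : LW n)
    (ht : ∀ i j k, ∑ l, X k l * c i j l = ∑ a, ∑ b, (X a i * g b j * d a b k +
      g a i * X b j * d a b k + g a i * g b j * η a b k)) : η = del d (X * h) := by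
  have hhg : h * g = 1 := mul_eq_one_comm.mp hgh
  rw [rel_iff] at hr
  have key : (br c).compr₂ X.toLin' = (br d).compl₁₂ X.toLin' g.toLin' +
      (br d).compl₁₂ g.toLin' X.toLin' + (br η).compl₁₂ g.toLin' g.toLin' := by
    apply bil_ext
    intro i j
    ext k
    have := ht i j k
    simp only [Finset.sum_add_distrib] at this
    simpa [br_apply, br_single, Matrix.mulVec, dotProduct, Pi.single_apply] using this
  have key2 : ∀ x y, X.mulVec (br c x y) = br d (X.mulVec x) (g.mulVec y) +
      br d (g.mulVec x) (X.mulVec y) + br η (g.mulVec x) (g.mulVec y) := by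
    intro x y
    simpa using congr($key x y)
  apply br_inj
  intro x y
  have e1 := key2 (h.mulVec x) (h.mulVec y)
  have e2 := hr (h.mulVec x) (h.mulVec y)
  simp only [Matrix.mulVec_mulVec, hgh, Matrix.one_mulVec] at e1 e2
  rw [br_del, ← e2]
  simp only [Matrix.mulVec_mulVec, mul_assoc, hhg, mul_one]
  rw [e1]
  abel

noncomputable def co {n : ℕ} (f : V n → V n → V n) : LW n :=
  fun i j => f (Pi.single i 1) (Pi.single j 1)

theorem br_co {n : ℕ} {f : V n → V n → V n} (hf : IsLieLaw f) (x y : V n) :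
    br (co f) x y = f x y := by
  obtain ⟨h1, h2, -, -⟩ := hf
  have z1 : ∀ z, f 0 z = 0 := fun z => by simpa using h1 1 0 0 z
  have z2 : ∀ z, f z 0 = 0 := fun z => by simpa using h2 1 z 0 0
  let F : V n →ₗ[ℂ] V n →ₗ[ℂ] V n := LinearMap.mk₂ ℂ f
    (fun a b z => by simpa using h1 1 a b z)
    (fun r a z => by simpa [z1] using h1 r a 0 z)
    (fun z a b => by simpa using h2 1 z a b)
    (fun r z a => by simpa [z2] using h2 r z a 0)
  have : br (co f) = F := by
    apply bil_ext
    intro i j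
    rw [br_single]; rfl
  rw [this]; rfl

theorem finrank_der {n : ℕ} {f : V n → V n → V n} (hf : IsLieLaw f) :
    finrank ℂ (derAlgebra f) = finrank ℂ (LinearMap.ker (del (co f))) := by
  let e : LM n ≃ₗ[ℂ] Module.End ℂ (V n) := Matrix.toLin'
  have : derAlgebra f = (LinearMap.ker (del (co f))).map (e : LM n →ₗ[ℂ] Module.End ℂ (V n)) := by
    apply le_antisymm
    · refine Submodule.span_le.mpr ?_
      intro D hD
      refine ⟨e.symm D, ?_, by simp⟩
      have h : ∀ x, (e.symm D).mulVec x = D x := fun x => by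
        rw [← Matrix.toLin'_apply]
        exact congr($(e.apply_symm_apply D) x)
      show del _ _ = 0
      rw [del_eq_zero_iff]
      intro x y
      simp only [h, br_co hf]
      exact hD x y
    · rintro _ ⟨Y, hY, rfl⟩
      refine Submodule.subset_span ?_
      have hY' : del _ _ = 0 := hY
      rw [del_eq_zero_iff] at hY'
      intro x y
      simpa [br_co hf, e] using hY' x y
  rw [this]
  exact LinearEquiv.finrank_map_eq e _

/-- variables: entries of `g`, of its inverse, slice coordinates, transversality certificates -/
abbrev SV (n r : ℕ) : Type := (Fin n × Fin n) ⊕ (Fin n × Fin n) ⊕ Fin r ⊕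
  ((Fin n × Fin n × Fin n) × Fin n × Fin n) ⊕ ((Fin n × Fin n × Fin n) × Fin r)

section Eqs
variable {n r : ℕ} {R : Type} [CommRing R] [Algebra ℂ R]

noncomputable def nuR (m : LW n) (b : Fin r → LW n) (z : SV n r → R) (i j k : Fin n) : R :=
  algebraMap ℂ R (m i j k) + ∑ q, z (.inr (.inr (.inl q))) * algebraMap ℂ R (b q i j k)

noncomputable def eq1 (z : SV n r → R) (w : Fin n × Fin n) : R :=
  ∑ a, z (.inl (w.1, a)) * z (.inr (.inl (a, w.2))) - if w.1 = w.2 then 1 else 0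

noncomputable def eq2 (c m : LW n) (b : Fin r → LW n) (z : SV n r → R)
    (w : Fin n × Fin n × Fin n) : R :=
  ∑ l, z (.inl (w.2.2, l)) * algebraMap ℂ R (c w.1 w.2.1 l) -
    ∑ a, ∑ a', z (.inl (a, w.1)) * z (.inl (a', w.2.1)) * nuR m b z a a' w.2.2

noncomputable def eq3 (m : LW n) (b : Fin r → LW n) (z : SV n r → R)
    (w : (Fin n × Fin n × Fin n) × (Fin n × Fin n × Fin n)) : R :=
  ∑ l, z (.inr (.inr (.inr (.inl (w.1, w.2.2.2, l))))) * nuR m b z w.2.1 w.2.2.1 l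
  - ∑ a, z (.inr (.inr (.inr (.inl (w.1, a, w.2.1))))) * nuR m b z a w.2.2.1 w.2.2.2
  - ∑ a, z (.inr (.inr (.inr (.inl (w.1, a, w.2.2.1))))) * nuR m b z w.2.1 a w.2.2.2
  + ∑ q, z (.inr (.inr (.inr (.inr (w.1, q))))) * algebraMap ℂ R (b q w.2.1 w.2.2.1 w.2.2.2)
  - if w.1 = w.2 then 1 else 0

variable {S : Type} [CommRing S] [Algebra ℂ S] (φ : R →ₐ[ℂ] S)

theorem map_nuR (m : LW n) (b : Fin r → LW n) (z : SV n r → R) (i j k : Fin n) :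
    φ (nuR m b z i j k) = nuR m b (fun v => φ (z v)) i j k := by
  simp [nuR]

theorem map_eq1 (z : SV n r → R) (w) : φ (eq1 z w) = eq1 (fun v => φ (z v)) w := by
  simp [eq1, apply_ite φ]

theorem map_eq2 (c m : LW n) (b : Fin r → LW n) (z : SV n r → R) (w) :
    φ (eq2 c m b z w) = eq2 c m b (fun v => φ (z v)) w := by
  simp [eq2, map_nuR]

theorem map_eq3 (m : LW n) (b : Fin r → LW n) (z : SV n r → R) (w) :
    φ (eq3 m b z w) = eq3 m b (fun v => φ (z v)) w := by
  simp [eq3, map_nuR, apply_ite φ]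

def Sol (c m : LW n) (b : Fin r → LW n) (z : SV n r → R) : Prop :=
  (∀ w, eq1 z w = 0) ∧ (∀ w, eq2 c m b z w = 0) ∧ (∀ w, eq3 m b z w = 0)

theorem Sol.map {c m : LW n} {b : Fin r → LW n} {z : SV n r → R} (h : Sol c m b z) :
    Sol c m b (fun v => φ (z v)) := by
  refine ⟨fun w => ?_, fun w => ?_, fun w => ?_⟩
  · rw [← map_eq1, h.1, map_zero]
  · rw [← map_eq2, h.2.1, map_zero]
  · rw [← map_eq3, h.2.2, map_zero]

end Eqs

theorem finite_sol {n r : ℕ} (c m : LW n) (b : Fin r → LW n) (q : Fin r)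
    (h : ∀ z : SV n r → DualNumber ℂ, Sol c m b z → (z (.inr (.inr (.inl q)))).snd = 0) :
    {w : ℂ | ∃ z : SV n r → ℂ, Sol c m b z ∧ z (.inr (.inr (.inl q))) = w}.Finite := by
  let X : SV n r → MvPolynomial (SV n r) ℂ := MvPolynomial.X
  have key : ∀ {S : Type} [CommRing S] [Algebra ℂ S] (z : SV n r → S),
      (∀ p ∈ Set.range (eq1 X) ∪ Set.range (eq2 c m b X) ∪ Set.range (eq3 m b X),
        MvPolynomial.aeval z p = 0) ↔ Sol c m b z := by
    intro S _ _ z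
    have hX : (fun v => MvPolynomial.aeval (R := ℂ) z (X v)) = z := by
      ext v; simp [X]
    simp only [Set.mem_union, or_imp, forall_and, Set.forall_mem_range, map_eq1, map_eq2, map_eq3,
      hX, Sol, and_assoc]
  have := finite_values_poly
    (Set.range (eq1 X) ∪ Set.range (eq2 c m b X) ∪ Set.range (eq3 m b X))
    (X (.inr (.inr (.inl q)))) (fun z hz => by simpa [X] using h z ((key z).mp hz))
  refine this.subset ?_
  rintro w ⟨z, hz, rfl⟩
  exact ⟨z, (key z).mpr hz, by simp [X]⟩

theorem LW_lin {n r : ℕ} (L : (Fin r → ℂ) →ₗ[ℂ] LW n) (s : Fin r → ℂ) (i j k : Fin n) :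
    L s i j k = ∑ q, s q * L (Pi.single q 1) i j k := by
  conv_lhs => rw [pi_eq_sum_univ' s]
  simp [Finset.sum_apply, smul_eq_mul]

theorem finite_slice {n r : ℕ} (c m : LW n) (L : (Fin r → ℂ) →ₗ[ℂ] LW n)
    (hL : Function.Injective L)
    (hdim : ∀ (d : LW n) (g h : LM n), g * h = 1 → LRel c g d →
      finrank ℂ (LinearMap.range (del d)) + r ≤ finrank ℂ (LW n)) :
    {s : Fin r → ℂ | (∃ g h : LM n, g * h = 1 ∧ LRel c g (m + L s)) ∧
      LinearMap.range (del (m + L s)) ⊔ LinearMap.range L = ⊤}.Finite := by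
  let b : Fin r → LW n := fun q => L (Pi.single q 1)
  let gO : (SV n r → ℂ) → LM n := fun z => Matrix.of fun a a' => z (.inl (a, a'))
  let hO : (SV n r → ℂ) → LM n := fun z => Matrix.of fun a a' => z (.inr (.inl (a, a')))
  let sO : (SV n r → ℂ) → (Fin r → ℂ) := fun z q => z (.inr (.inr (.inl q)))
  have hnu : ∀ z : SV n r → ℂ, ∀ i j k, nuR m b z i j k = (m + L (sO z)) i j k := by
    intro z i j k
    simp only [nuR, Pi.add_apply, LW_lin L (sO z)]
    rfl
  -- complex solutions
  have hsol : ∀ z : SV n r → ℂ, Sol c m b z → gO z * hO z = 1 ∧ LRel c (gO z) (m + L (sO z)) ∧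
      LinearMap.range (del (m + L (sO z))) ⊔ LinearMap.range L = ⊤ := by
    rintro z ⟨h1, h2, h3⟩
    refine ⟨?_, ?_, ?_⟩
    · ext a a'
      have := h1 (a, a')
      simp only [eq1, sub_eq_zero] at this
      rw [Matrix.mul_apply, Matrix.one_apply]
      exact this
    · intro i j k
      have := h2 (i, j, k)
      simp only [eq2, sub_eq_zero, hnu] at this
      exact this
    · rw [eq_top_iff]
      intro x _
      have hx : x = ∑ w : Fin n × Fin n × Fin n, x w.1 w.2.1 w.2.2 •
          (del (m + L (sO z)) (Matrix.of fun a a' => z (.inr (.inr (.inr (.inl (w, a, a')))))) +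
            L (fun q => z (.inr (.inr (.inr (.inr (w, q))))))) := by
        ext i j k
        have : ∀ w : Fin n × Fin n × Fin n,
          (del (m + L (sO z)) (Matrix.of fun a a' => z (.inr (.inr (.inr (.inl (w, a, a')))))) +
            L (fun q => z (.inr (.inr (.inr (.inr (w, q))))))) i j k =
              if w = (i, j, k) then 1 else 0 := by
          intro w
          have := h3 (w, (i, j, k))
          simp only [eq3, sub_eq_zero, hnu] at this
          rw [← this]
          rw [Pi.add_apply, Pi.add_apply, Pi.add_apply,
            LW_lin L (fun q => z (.inr (.inr (.inr (.inr (w, q)))))), del_apply]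
          rfl
        simp only [Finset.sum_apply, Pi.smul_apply, this, smul_eq_mul, mul_ite, mul_one, mul_zero,
          Finset.sum_ite_eq', Finset.sum_ite_eq, Finset.mem_univ, if_true]
      rw [hx]
      refine Submodule.sum_mem _ fun w _ => Submodule.smul_mem _ _ (Submodule.add_mem_sup ?_ ?_)
      · exact ⟨_, rfl⟩
      · exact ⟨_, rfl⟩
  have hsol' : ∀ s, (∃ g h : LM n, g * h = 1 ∧ LRel c g (m + L s)) →
      LinearMap.range (del (m + L s)) ⊔ LinearMap.range L = ⊤ →
      ∃ z : SV n r → ℂ, Sol c m b z ∧ sO z = s := by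
    rintro s ⟨g, h, hgh, hr⟩ htop
    have : ∀ w : Fin n × Fin n × Fin n, ∃ (Y : LM n) (u : Fin r → ℂ),
        del (m + L s) Y + L u = fun i j k => if w = (i, j, k) then 1 else 0 := by
      intro w
      have hw : (fun i j k => if w = (i, j, k) then (1 : ℂ) else 0 : LW n) ∈
        LinearMap.range (del (m + L s)) ⊔ LinearMap.range L := htop ▸ Submodule.mem_top
      obtain ⟨_, ⟨Y, rfl⟩, _, ⟨u, rfl⟩, h⟩ := Submodule.mem_sup.mp hw
      exact ⟨Y, u, h⟩
    choose Y u hYu using this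
    let z : SV n r → ℂ := fun v => match v with
      | .inl (a, a') => g a a'
      | .inr (.inl (a, a')) => h a a'
      | .inr (.inr (.inl q)) => s q
      | .inr (.inr (.inr (.inl (w, a, a')))) => Y w a a'
      | .inr (.inr (.inr (.inr (w, q)))) => u w q
    have hs : sO z = s := rfl
    refine ⟨z, ⟨?_, ?_, ?_⟩, hs⟩
    · rintro ⟨a, a'⟩
      have := congr($hgh a a')
      rw [Matrix.mul_apply, Matrix.one_apply] at this
      simp only [eq1, sub_eq_zero]
      exact this
    · rintro ⟨i, j, k⟩
      simp only [eq2, sub_eq_zero, hnu, hs]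
      exact hr i j k
    · rintro ⟨w, i, j, k⟩
      have := congr($(hYu w) i j k)
      simp only [Pi.add_apply, del_apply, LW_lin L (u w)] at this
      simp only [eq3, sub_eq_zero, hnu, hs]
      exact this
  -- tangent vectors
  have htan : ∀ q, ∀ z : SV n r → DualNumber ℂ, Sol c m b z →
      (z (.inr (.inr (.inl q)))).snd = 0 := by
    intro q z hz
    let z0 : SV n r → ℂ := fun v => (z v).fst
    have hz0 : Sol c m b z0 := hz.map (TrivSqZeroExt.fstHom ℂ ℂ ℂ)
    obtain ⟨hgh, hr, htop⟩ := hsol z0 hz0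
    let z1 : SV n r → ℂ := fun v => (z v).snd
    have hn0 : ∀ i j k, (nuR m b z i j k).fst = (m + L (sO z0)) i j k := by
      intro i j k
      rw [← hnu]
      exact map_nuR (TrivSqZeroExt.fstHom ℂ ℂ ℂ) m b z i j k
    have hn1 : ∀ i j k, (nuR m b z i j k).snd = L (sO z1) i j k := by
      intro i j k
      simp [nuR, LW_lin L (sO z1), TrivSqZeroExt.algebraMap_eq_inl, TrivSqZeroExt.snd_sum, sO, z1,
        b, mul_comm]
    have hη := tangent_eq hgh hr (gO z1) (L (sO z1)) (by
      intro i j k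
      have := congr(TrivSqZeroExt.snd $(hz.2.1 (i, j, k)))
      simp only [eq2, TrivSqZeroExt.snd_sub, TrivSqZeroExt.snd_sum, DualNumber.snd_mul,
        TrivSqZeroExt.fst_mul, hn0, hn1, TrivSqZeroExt.algebraMap_eq_inl, TrivSqZeroExt.snd_inl,
        TrivSqZeroExt.fst_inl, TrivSqZeroExt.snd_zero, sub_eq_zero] at this
      refine Eq.trans ?_ (this.trans ?_)
      · refine Finset.sum_congr rfl fun l _ => ?_
        simp [gO, z1]
      · refine Finset.sum_congr rfl fun a _ => Finset.sum_congr rfl fun a' _ => ?_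
        simp only [gO, z1, z0, Matrix.of_apply]
        ring)
    have hdim' := hdim _ _ _ hgh hr
    have hrL : finrank ℂ (LinearMap.range L) = r := by
      rw [LinearMap.finrank_range_of_inj hL]; simp
    have hsum := Submodule.finrank_sup_add_finrank_inf_eq
      (LinearMap.range (del (m + L (sO z0)))) (LinearMap.range L)
    rw [htop, finrank_top, hrL] at hsum
    have h0 : LinearMap.range (del (m + L (sO z0))) ⊓ LinearMap.range L = ⊥ := by
      apply Submodule.finrank_eq_zero.mp
      omega
    have hmem : L (sO z1) ∈ LinearMap.range (del (m + L (sO z0))) ⊓ LinearMap.range L :=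
      ⟨⟨_, hη.symm⟩, ⟨_, rfl⟩⟩
    rw [h0, Submodule.mem_bot] at hmem
    have := hL (hmem.trans (map_zero L).symm)
    exact congr($this q)
  refine (Set.Finite.pi' fun q => finite_sol c m b q (htan q)).subset ?_
  rintro s ⟨hs1, hs2⟩ q
  obtain ⟨z, hz, rfl⟩ := hsol' s hs1 hs2
  exact ⟨z, hz, rfl⟩

theorem transversal_near {n r : ℕ} (m : LW n) (L : (Fin r → ℂ) →ₗ[ℂ] LW n)
    (htop : LinearMap.range (del m) ⊔ LinearMap.range L = ⊤) :
    ∀ᶠ s in 𝓝 (0 : Fin r → ℂ), LinearMap.range (del (m + L s)) ⊔ LinearMap.range L = ⊤ := by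
  let B := finBasis ℂ (LW n)
  have : ∀ w, ∃ (Y : LM n) (u : Fin r → ℂ), del m Y + L u = B w := by
    intro w
    have hw : B w ∈ LinearMap.range (del m) ⊔ LinearMap.range L := htop ▸ Submodule.mem_top
    obtain ⟨_, ⟨Y, rfl⟩, _, ⟨u, rfl⟩, h⟩ := Submodule.mem_sup.mp hw
    exact ⟨Y, u, h⟩
  choose Y u hYu using this
  let v : (Fin r → ℂ) → Fin (finrank ℂ (LW n)) → LW n := fun s w => del (m + L s) (Y w) + L (u w)
  have hLc : Continuous L := L.continuous_of_finiteDimensional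
  have hv : Continuous v := by
    refine continuous_pi fun w => continuous_pi fun i => continuous_pi fun j =>
      continuous_pi fun k => ?_
    simp only [v, Pi.add_apply, del_apply]
    fun_prop
  have hv0 : v 0 = B := by
    ext1 w
    simp only [v, map_zero, add_zero, hYu]
  have hopen := (isOpen_setOfPred_linearIndependent (𝕜 := ℂ) (E := LW n)
    (ι := Fin (finrank ℂ (LW n)))).preimage hv
  have h0 : (0 : Fin r → ℂ) ∈ v ⁻¹' {f | LinearIndependent ℂ f} := by
    show LinearIndependent ℂ (v 0)
    rw [hv0]; exact B.linearIndependent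
  filter_upwards [hopen.mem_nhds h0] with s hs
  have hs' : LinearIndependent ℂ (v s) := hs
  have := hs'.span_eq_top_of_card_eq_finrank' (by simp)
  rw [eq_top_iff, ← this, Submodule.span_le]
  rintro _ ⟨w, rfl⟩
  exact Submodule.add_mem_sup ⟨_, rfl⟩ ⟨_, rfl⟩

/-- The map whose openness yields the slice points. -/
noncomputable def sliceMap {n r : ℕ} (m : LW n) (L : (Fin r → ℂ) →ₗ[ℂ] LW n) :
    (Fin n → Fin n → ℂ) × (Fin r → ℂ) × LW n → LW n × LW n :=
  fun p => (p.2.2, fun i j k => ∑ l, p.1 k l * p.2.2 i j l -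
    ∑ a, ∑ b, p.1 a i * p.1 b j * (m + L p.2.1) a b k)

theorem sliceMap_open {n r : ℕ} (m : LW n) (L : (Fin r → ℂ) →ₗ[ℂ] LW n)
    (htop : LinearMap.range (del m) ⊔ LinearMap.range L = ⊤) :
    map (sliceMap m L) (𝓝 ((1 : LM n), 0, m)) = 𝓝 (m, 0) := by
  let p0 : (Fin n → Fin n → ℂ) × (Fin r → ℂ) × LW n := ((1 : LM n), 0, m)
  let Lc : (Fin r → ℂ) →L[ℂ] LW n := L.toContinuousLinearMap
  have hcd : ContDiff ℂ 1 (sliceMap m L) := by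
    have hL : ContDiff ℂ 1 (fun s => L s) := Lc.contDiff
    refine contDiff_snd.snd.prodMk ?_
    refine contDiff_pi.mpr fun i => contDiff_pi.mpr fun j => contDiff_pi.mpr fun k => ?_
    have hL' : ∀ a b, ContDiff ℂ 1
        (fun p : (Fin n → Fin n → ℂ) × (Fin r → ℂ) × LW n => (m + L p.2.1) a b k) := by
      intro a b
      have h1 : ContDiff ℂ 1
        (fun p : (Fin n → Fin n → ℂ) × (Fin r → ℂ) × LW n => m + L p.2.1) :=
        contDiff_const.add (hL.comp contDiff_snd.fst)
      exact contDiff_pi.mp (contDiff_pi.mp (contDiff_pi.mp h1 a) b) k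
    fun_prop
  have hs : HasStrictFDerivAt (sliceMap m L) (fderiv ℂ (sliceMap m L) p0) p0 :=
    hcd.contDiffAt.hasStrictFDerivAt one_ne_zero
  have hval : sliceMap m L p0 = (m, 0) := by
    refine Prod.ext rfl ?_
    ext i j k
    simp [sliceMap, p0, Matrix.one_apply]
  have hder : ∀ (X : LM n) (s : Fin r → ℂ) (η : LW n),
      fderiv ℂ (sliceMap m L) p0 (X, s, η) = (η, del m X + η - L s) := by
    intro X s η
    have hline : HasDerivAt (fun t : ℂ => p0 + t • ((X, s, η) : (Fin n → Fin n → ℂ) × (Fin r → ℂ) × LW n)) (X, s, η) 0 := by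
      simpa using ((hasDerivAt_id (0 : ℂ)).smul_const
        ((X, s, η) : (Fin n → Fin n → ℂ) × (Fin r → ℂ) × LW n)).const_add p0
    have h1 := (hs.hasFDerivAt.comp_hasDerivAt_of_eq (0 : ℂ) hline (by simp))
    have h2 : HasDerivAt (sliceMap m L ∘ fun t : ℂ =>
        p0 + t • ((X, s, η) : (Fin n → Fin n → ℂ) × (Fin r → ℂ) × LW n))
        (η, del m X + η - L s) 0 := by
      refine HasDerivAt.prodMk ?_ ?_
      · simpa [p0] using ((hasDerivAt_id (0 : ℂ)).smul_const η).const_add m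
      · refine hasDerivAt_pi.mpr fun i => hasDerivAt_pi.mpr fun j => hasDerivAt_pi.mpr fun k => ?_
        have hLt : ∀ (t : ℂ) (a b : Fin n),
            (m + L (0 + t • s)) a b k = m a b k + t * L s a b k := by
          intro t a b
          simp
        have hq : ∀ x y : ℂ, HasDerivAt (fun t : ℂ => x + t * y) y 0 := fun x y => by
          simpa using ((hasDerivAt_id (0 : ℂ)).mul_const y).const_add x
        have key := (HasDerivAt.fun_sum (u := Finset.univ) fun l _ =>
          (hq ((1 : LM n) k l) (X k l)).mul (hq (m i j l) (η i j l))).sub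
          (HasDerivAt.fun_sum (u := Finset.univ) fun a _ =>
            HasDerivAt.fun_sum (u := Finset.univ) fun b _ =>
          (((hq ((1 : LM n) a i) (X a i)).mul (hq ((1 : LM n) b j) (X b j))).mul
            (hq (m a b k) (L s a b k))))
        convert key using 1
        · funext t
          show (∑ l, ((1 : LM n) k l + t * X k l) * (m i j l + t * η i j l) -
            ∑ a, ∑ b, ((1 : LM n) a i + t * X a i) * ((1 : LM n) b j + t * X b j) *
              (m + L (0 + t • s)) a b k) = _
          simp only [hLt]
          rfl
        · simp only [Pi.sub_apply, Pi.add_apply, Pi.mul_apply, del_apply]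
          simp [Matrix.one_apply, Finset.sum_add_distrib, add_mul]
          ring
    exact h1.unique h2
  have := hs.map_nhds_eq_of_surj (by
    rw [eq_top_iff]
    rintro ⟨η, ζ⟩ _
    have hw : ζ - η ∈ LinearMap.range (del m) ⊔ LinearMap.range L := htop ▸ Submodule.mem_top
    obtain ⟨_, ⟨X, rfl⟩, _, ⟨u, rfl⟩, h⟩ := Submodule.mem_sup.mp hw
    refine ⟨(X, -u, η), ?_⟩
    show fderiv ℂ (sliceMap m L) p0 (X, -u, η) = _
    rw [hder, map_neg, sub_neg_eq_add]
    refine Prod.ext rfl ?_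
    show del m X + η + L u = ζ
    rw [add_right_comm, h]; abel)
  rw [hval] at this
  exact this

theorem core {n : ℕ} (c m : LW n)
    (hcl : m ∈ closure {d : LW n | ∃ g h : LM n, g * h = 1 ∧ LRel c g d})
    (hrank : finrank ℂ (LinearMap.ker (del m)) ≤ finrank ℂ (LinearMap.ker (del c))) :
    ∃ g h : LM n, g * h = 1 ∧ LRel c g m := by
  obtain ⟨S, hS⟩ := Submodule.exists_isCompl (LinearMap.range (del m))
  let r := finrank ℂ S
  let L : (Fin r → ℂ) →ₗ[ℂ] LW n := S.subtype ∘ₗ (finBasis ℂ S).equivFun.symm.toLinearMap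
  have hL : Function.Injective L :=
    S.subtype_injective.comp (finBasis ℂ S).equivFun.symm.injective
  have hLr : LinearMap.range L = S := by
    rw [LinearMap.range_comp, LinearEquiv.range, Submodule.map_top, Submodule.range_subtype]
  have htop : LinearMap.range (del m) ⊔ LinearMap.range L = ⊤ := by
    rw [hLr]; exact hS.sup_eq_top
  have hfin := finite_slice c m L hL (by
    intro d g h hgh hr
    have h1 := finrank_ker_le hgh hr
    have h2 := LinearMap.finrank_range_add_finrank_ker (del d)
    have h3 := LinearMap.finrank_range_add_finrank_ker (del m)
    have h4 := Submodule.finrank_add_eq_of_isCompl hS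
    omega)
  by_contra hno
  set Sig := {s : Fin r → ℂ | (∃ g h : LM n, g * h = 1 ∧ LRel c g (m + L s)) ∧
      LinearMap.range (del (m + L s)) ⊔ LinearMap.range L = ⊤} with hSig
  have h0 : (0 : Fin r → ℂ) ∉ Sig := by
    rintro ⟨h, -⟩
    rw [map_zero, add_zero] at h
    exact hno h
  have hN1 : ∀ᶠ s in 𝓝 (0 : Fin r → ℂ), s ∉ Sig := hfin.isClosed.isOpen_compl.mem_nhds h0
  have hN2 := transversal_near m L htop
  have hdet : ∀ᶠ x in 𝓝 (1 : LM n), x.det ≠ 0 :=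
    (Continuous.matrix_det continuous_id).continuousAt.eventually_ne (by simp)
  have hN : ∀ᶠ p in 𝓝 (((1 : LM n), 0, m) : (Fin n → Fin n → ℂ) × (Fin r → ℂ) × LW n),
      Matrix.det (p.1 : LM n) ≠ 0 ∧ p.2.1 ∉ Sig ∧
        LinearMap.range (del (m + L p.2.1)) ⊔ LinearMap.range L = ⊤ := by
    have t1 : Tendsto (fun p : (Fin n → Fin n → ℂ) × (Fin r → ℂ) × LW n => p.1)
      (𝓝 ((1 : LM n), 0, m)) (𝓝 (1 : LM n)) := continuous_fst.continuousAt
    have t2 : Tendsto (fun p : (Fin n → Fin n → ℂ) × (Fin r → ℂ) × LW n => p.2.1)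
      (𝓝 ((1 : LM n), 0, m)) (𝓝 0) := (continuous_snd.fst).continuousAt
    exact (t1.eventually hdet).and ((t2.eventually hN1).and (t2.eventually hN2))
  have himg := image_mem_map (m := sliceMap m L) hN
  rw [sliceMap_open m L htop] at himg
  have t3 : Tendsto (fun d : LW n => (d, (0 : LW n))) (𝓝 m) (𝓝 (m, 0)) :=
    (Continuous.prodMk continuous_id continuous_const).continuousAt
  obtain ⟨d, hd, g, h, hgh, hr⟩ := mem_closure_iff_nhds.mp hcl _ (t3 himg)
  obtain ⟨⟨x, s, d'⟩, ⟨hx, hs, ht⟩, he⟩ := hd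
  obtain ⟨x', rfl⟩ : ∃ x' : LM n, (x' : Fin n → Fin n → ℂ) = x := ⟨x, rfl⟩
  have hd' : d' = d := congrArg Prod.fst he
  subst hd'
  have he2 : ∀ i j k, _ := fun i j k => congrFun (congrFun (congrFun (congrArg Prod.snd he) i) j) k
  have hrel : LRel d' x' (m + L s) := fun i j k => sub_eq_zero.mp (he2 i j k)
  refine hs ⟨⟨x' * g, h * x'⁻¹, ?_, hr.trans hrel⟩, ht⟩
  rw [Matrix.mul_assoc, ← Matrix.mul_assoc g, hgh, Matrix.one_mul]
  exact Matrix.mul_nonsing_inv _ (Ne.isUnit hx)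

theorem stmt5 (n : ℕ) (lam mu : V n → V n → V n)
    (hlam : IsLieLaw lam) (hmu : IsLieLaw mu)
    (hdeg : Degenerates lam mu) (hnontriv : mu ∉ lieOrbit lam) :
    Module.finrank ℂ (derAlgebra lam) < Module.finrank ℂ (derAlgebra mu) := by
  by_contra hlt
  rw [not_lt, finrank_der hlam, finrank_der hmu] at hlt
  apply hnontriv
  have hcont : Continuous (co : (V n → V n → V n) → LW n) := by
    unfold co
    fun_prop
  have hcl : co mu ∈ closure {d : LW n | ∃ g h : LM n, g * h = 1 ∧ LRel (co lam) g d} := by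
    refine closure_mono ?_ (image_closure_subset_closure_image hcont ⟨mu, hdeg, rfl⟩)
    rintro _ ⟨_, ⟨g, rfl⟩, rfl⟩
    refine ⟨LinearMap.toMatrix' g.toLinearMap, LinearMap.toMatrix' g.symm.toLinearMap, ?_, ?_⟩
    · rw [← LinearMap.toMatrix'_comp]; simp
    · rw [rel_iff]
      have hB : br (co (act g lam)) = ((br (co lam)).compl₁₂ g.symm.toLinearMap
          g.symm.toLinearMap).compr₂ g.toLinearMap := by
        apply bil_ext
        intro i j
        rw [br_single]
        simp [co, act, br_co hlam]
      intro x y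
      rw [hB]
      simp [LinearMap.toMatrix'_mulVec]
  obtain ⟨g, h, hgh, hr⟩ := core (co lam) (co mu) hcl hlt
  rw [rel_iff] at hr
  refine ⟨Matrix.toLin'OfInv (mul_eq_one_comm.mp hgh) hgh, ?_⟩
  funext x y
  have h1 := hr (h.mulVec x) (h.mulVec y)
  rw [Matrix.mulVec_mulVec, Matrix.mulVec_mulVec, hgh, Matrix.one_mulVec, Matrix.one_mulVec,
    br_co hlam, br_co hmu] at h1
  exact h1.symm
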